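/- arXiv:2310.05027 — 4 statements merged into one kernel-verified Lean document; each statement's English description precedes it below -/
import Mathlib

section
/- Let a1=(x1,y1,z1), a2=(x2,y2,z2), a3=(x3,y3,z3), a4=(x4,y4,z4) be four affinely independent points in ℝ³, let D be the solid tetrahedron given by their convex hull, and let V be the Lebesgue volume of D. Then ∫_D (y² + z²) dV = V·(y1² + y1y2 + y2² + y1y3 + y2y3 + y3² + y1y4 + y2y4 + y3y4 + y4² + z1² + z1z2 + z2² + z1z3 + z2z3 + z3² + z1z4 + z2z4 + z3z4 + z4²)/10. -/
open MeasureTheory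

theorem isClosed_triangle (s : ℝ) :
    IsClosed {p : ℝ × ℝ | 0 ≤ p.1 ∧ 0 ≤ p.2 ∧ p.1 + p.2 ≤ s} := by
  simp only [Set.ofPred_and]
  exact (isClosed_le (by fun_prop) (by fun_prop)).inter
    ((isClosed_le (by fun_prop) (by fun_prop)).inter (isClosed_le (by fun_prop) (by fun_prop)))

theorem setIntegral_triangle {s : ℝ} (hs : 0 ≤ s) {f : ℝ × ℝ → ℝ} (hf : Continuous f) :
    ∫ p in {p : ℝ × ℝ | 0 ≤ p.1 ∧ 0 ≤ p.2 ∧ p.1 + p.2 ≤ s}, f p =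
      ∫ x in 0..s, ∫ y in 0..(s - x), f (x, y) := by
  set T := {p : ℝ × ℝ | 0 ≤ p.1 ∧ 0 ≤ p.2 ∧ p.1 + p.2 ≤ s} with hT
  have hclosed : IsClosed T := isClosed_triangle s
  have hcompact : IsCompact T := by
    refine (isCompact_Icc (a := ((0 : ℝ), (0 : ℝ))) (b := (s, s))).of_isClosed_subset hclosed ?_
    rintro ⟨x, y⟩ ⟨hx, hy, hxy⟩
    simp only [Set.mem_Icc, Prod.mk_le_mk] at *
    refine ⟨⟨hx, hy⟩, by linarith, by linarith⟩
  have hint : Integrable (T.indicator f) (volume.prod volume) :=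
    (integrable_indicator_iff hclosed.measurableSet).2
      (hf.continuousOn.integrableOn_compact hcompact)
  rw [← integral_indicator hclosed.measurableSet, Measure.volume_eq_prod, integral_prod _ hint,
    intervalIntegral.integral_of_le hs, ← integral_Icc_eq_integral_Ioc,
    ← integral_indicator measurableSet_Icc]
  congr 1 with x
  by_cases hx : x ∈ Set.Icc 0 s
  · rw [Set.indicator_of_mem hx, intervalIntegral.integral_of_le (by linarith [hx.2]),
      ← integral_Icc_eq_integral_Ioc, ← integral_indicator measurableSet_Icc]
    congr 1 with y
    refine Set.indicator_eq_indicator ?_ rfl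
    simp only [hT, Set.mem_ofPred_eq, Set.mem_Icc]
    exact ⟨fun h => ⟨h.2.1, by linarith⟩, fun h => ⟨hx.1, h.1, by linarith⟩⟩
  · rw [Set.indicator_of_notMem hx]
    refine integral_eq_zero_of_ae (Filter.Eventually.of_forall fun y => ?_)
    refine Set.indicator_of_notMem (fun h => hx ⟨h.1, ?_⟩) _
    have := h.2.1
    have := h.2.2
    simp only at *
    linarith

/-- The corner tetrahedron bounded by the coordinate planes and the plane `x + y + z = 1`. -/
def cornerTetrahedron : Set (ℝ × ℝ × ℝ) :=
  {p | 0 ≤ p.1 ∧ 0 ≤ p.2.1 ∧ 0 ≤ p.2.2 ∧ p.1 + p.2.1 + p.2.2 ≤ 1}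

theorem isClosed_cornerTetrahedron : IsClosed cornerTetrahedron := by
  simp only [cornerTetrahedron, Set.ofPred_and]
  exact (isClosed_le (by fun_prop) (by fun_prop)).inter
    ((isClosed_le (by fun_prop) (by fun_prop)).inter
      ((isClosed_le (by fun_prop) (by fun_prop)).inter (isClosed_le (by fun_prop) (by fun_prop))))

theorem isCompact_cornerTetrahedron : IsCompact cornerTetrahedron := by
  refine (isCompact_Icc (a := ((0 : ℝ), (0 : ℝ), (0 : ℝ))) (b := (1, 1, 1))).of_isClosed_subset
    isClosed_cornerTetrahedron ?_
  rintro ⟨x, y, z⟩ ⟨hx, hy, hz, hxyz⟩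
  simp only [Set.mem_Icc, Prod.mk_le_mk] at *
  exact ⟨⟨hx, hy, hz⟩, by linarith, by linarith, by linarith⟩

theorem convex_cornerTetrahedron : Convex ℝ cornerTetrahedron := by
  rintro ⟨x, y, z⟩ ⟨hx, hy, hz, h⟩ ⟨x', y', z'⟩ ⟨hx', hy', hz', h'⟩ a b ha hb hab
  simp only [cornerTetrahedron, Prod.smul_mk, Prod.mk_add_mk, smul_eq_mul, Set.mem_ofPred_eq] at *
  refine ⟨by positivity, by positivity, by positivity, ?_⟩
  nlinarith [mul_le_mul_of_nonneg_left h ha, mul_le_mul_of_nonneg_left h' hb]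

theorem setIntegral_cornerTetrahedron {f : ℝ × ℝ × ℝ → ℝ} (hf : Continuous f) :
    ∫ p in cornerTetrahedron, f p =
      ∫ x in 0..1, ∫ y in 0..(1 - x), ∫ z in 0..(1 - x - y), f (x, y, z) := by
  have hmeas := isClosed_cornerTetrahedron.measurableSet
  have hint : Integrable (cornerTetrahedron.indicator f) (volume.prod volume) :=
    (integrable_indicator_iff hmeas).2
      (hf.continuousOn.integrableOn_compact isCompact_cornerTetrahedron)
  rw [← integral_indicator hmeas, Measure.volume_eq_prod, integral_prod _ hint,
    intervalIntegral.integral_of_le zero_le_one, ← integral_Icc_eq_integral_Ioc,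
    ← integral_indicator measurableSet_Icc]
  congr 1 with x
  by_cases hx : x ∈ Set.Icc 0 1
  · rw [Set.indicator_of_mem hx, ← setIntegral_triangle (f := fun p => f (x, p))
      (by linarith [hx.2]) (by fun_prop), ← integral_indicator (isClosed_triangle _).measurableSet]
    congr 1 with p
    refine Set.indicator_eq_indicator ?_ rfl
    simp only [cornerTetrahedron, Set.mem_ofPred_eq]
    exact ⟨fun h => ⟨h.2.1, h.2.2.1, by linarith⟩, fun h => ⟨hx.1, h.1, h.2.1, by linarith⟩⟩
  · rw [Set.indicator_of_notMem hx]
    refine integral_eq_zero_of_ae (Filter.Eventually.of_forall fun p => ?_)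
    refine Set.indicator_of_notMem (fun h => hx ⟨h.1, ?_⟩) _
    obtain ⟨h₁, h₂, h₃, h₄⟩ := h
    simp only at *
    linarith

theorem intervalIntegral_quartic (c₀ c₁ c₂ c₃ c₄ t : ℝ) :
    ∫ x in 0..t, (c₀ + c₁ * x + c₂ * x ^ 2 + c₃ * x ^ 3 + c₄ * x ^ 4) =
      c₀ * t + c₁ * t ^ 2 / 2 + c₂ * t ^ 3 / 3 + c₃ * t ^ 4 / 4 + c₄ * t ^ 5 / 5 := by
  rw [intervalIntegral.integral_eq_sub_of_hasDerivAt (f := fun x => c₀ * x + c₁ * x ^ 2 / 2 +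
    c₂ * x ^ 3 / 3 + c₃ * x ^ 4 / 4 + c₄ * x ^ 5 / 5)]
  · simp
  · intro x _
    have h (n : ℕ) : HasDerivAt (fun x : ℝ => x ^ n) (n * x ^ (n - 1)) x := hasDerivAt_pow n x
    refine (((((hasDerivAt_id x).const_mul c₀).add (((h 2).const_mul c₁).div_const 2)).add
      (((h 3).const_mul c₂).div_const 3)).add (((h 4).const_mul c₃).div_const 4) |>.add
      (((h 5).const_mul c₄).div_const 5)).congr_deriv ?_
    norm_num
    ring
  · exact Continuous.intervalIntegrable (by fun_prop) _ _

theorem setIntegral_cornerTetrahedron_sq (a b c d : ℝ) :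
    ∫ p in cornerTetrahedron, (a + (p.1 * (b - a) + p.2.1 * (c - a) + p.2.2 * (d - a))) ^ 2 =
      (a ^ 2 + a * b + b ^ 2 + a * c + b * c + c ^ 2 + a * d + b * d + c * d + d ^ 2) / 60 := by
  rw [setIntegral_cornerTetrahedron (by fun_prop)]
  set B := b - a with hB
  set C := c - a with hC
  set E := d - a with hE
  have h₁ (x y : ℝ) : ∫ z in 0..(1 - x - y), (a + (x * B + y * C + z * E)) ^ 2 =
      (a + x * B + y * C) ^ 2 * (1 - x - y) + (a + x * B + y * C) * E * (1 - x - y) ^ 2 +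
        E ^ 2 * (1 - x - y) ^ 3 / 3 := by
    convert intervalIntegral_quartic ((a + x * B + y * C) ^ 2) (2 * (a + x * B + y * C) * E)
      (E ^ 2) 0 0 (1 - x - y) using 1
    · congr 1 with z
      ring
    · ring
  have h₂ (x : ℝ) : ∫ y in 0..(1 - x), ((a + x * B + y * C) ^ 2 * (1 - x - y) +
      (a + x * B + y * C) * E * (1 - x - y) ^ 2 + E ^ 2 * (1 - x - y) ^ 3 / 3) =
      (a + x * B) ^ 2 * (1 - x) ^ 2 / 2 + (a + x * B) * (C + E) * (1 - x) ^ 3 / 3 +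
        (C ^ 2 + C * E + E ^ 2) * (1 - x) ^ 4 / 12 := by
    set s := 1 - x
    set m := a + x * B
    convert intervalIntegral_quartic (m ^ 2 * s + m * E * s ^ 2 + E ^ 2 * s ^ 3 / 3)
      (2 * m * C * s - m ^ 2 + C * E * s ^ 2 - 2 * m * E * s - E ^ 2 * s ^ 2)
      (C ^ 2 * s - 2 * m * C + m * E - 2 * C * E * s + E ^ 2 * s)
      (-C ^ 2 + C * E - E ^ 2 / 3) 0 s using 1
    · congr 1 with y
      ring
    · ring
  simp only [h₁, h₂]
  have h₃ : ∫ x in (0 : ℝ)..1, ((a + x * B) ^ 2 * (1 - x) ^ 2 / 2 +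
      (a + x * B) * (C + E) * (1 - x) ^ 3 / 3 + (C ^ 2 + C * E + E ^ 2) * (1 - x) ^ 4 / 12) =
      a ^ 2 / 6 + a * (B + C + E) / 12 +
        (B ^ 2 + C ^ 2 + E ^ 2 + B * C + B * E + C * E) / 60 := by
    set P := C + E
    set Q := C ^ 2 + C * E + E ^ 2 with hQ
    convert intervalIntegral_quartic (a ^ 2 / 2 + a * P / 3 + Q / 12)
      (a * B - a ^ 2 + (B - 3 * a) * P / 3 - Q / 3)
      (B ^ 2 / 2 - 2 * a * B + a ^ 2 / 2 + (a - B) * P + Q / 2)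
      (a * B - B ^ 2 + (3 * B - a) * P / 3 - Q / 3) (B ^ 2 / 2 - B * P / 3 + Q / 12) 1 using 1
    · congr 1 with x
      ring
    · simp only [P, hQ]
      ring
  rw [h₃, hB, hC, hE]
  ring

theorem volume_real_cornerTetrahedron : volume.real cornerTetrahedron = 1 / 6 := by
  have h := setIntegral_cornerTetrahedron_sq 1 1 1 1
  norm_num at h
  simpa using h

theorem exists_setIntegral_convexHull_eq {a₁ a₂ a₃ a₄ : EuclideanSpace ℝ (Fin 3)}
    (h : AffineIndependent ℝ ![a₁, a₂, a₃, a₄]) :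
    ∃ c : ℝ, ∀ f : EuclideanSpace ℝ (Fin 3) → ℝ,
      ∫ x in convexHull ℝ {a₁, a₂, a₃, a₄}, f x = c * ∫ p in cornerTetrahedron,
        f (a₁ + (p.1 • (a₂ - a₁) + p.2.1 • (a₃ - a₁) + p.2.2 • (a₄ - a₁))) := by
  let L₀ : ℝ × ℝ × ℝ →ₗ[ℝ] EuclideanSpace ℝ (Fin 3) :=
    (LinearMap.toSpanSingleton ℝ _ (a₂ - a₁)).coprod
      ((LinearMap.toSpanSingleton ℝ _ (a₃ - a₁)).coprod
        (LinearMap.toSpanSingleton ℝ _ (a₄ - a₁)))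
  have hL₀ (p : ℝ × ℝ × ℝ) :
      L₀ p = p.1 • (a₂ - a₁) + p.2.1 • (a₃ - a₁) + p.2.2 • (a₄ - a₁) := by
    simp [L₀, add_assoc]
  have hli : LinearIndependent ℝ ![a₂ - a₁, a₃ - a₁, a₄ - a₁] := by
    have := (affineIndependent_iff_linearIndependent_vsub ℝ _ (0 : Fin 4)).1 h
    have h' := this.comp
      (fun i : Fin 3 => (⟨i.succ, Fin.succ_ne_zero i⟩ : {x : Fin 4 // x ≠ 0}))
      (fun i j hij => by simpa using hij)
    convert h' using 1
    · ext i
      fin_cases i <;> rfl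
    · rfl
  have hinj : Function.Injective L₀ := by
    rw [← LinearMap.ker_eq_bot, LinearMap.ker_eq_bot']
    intro p hp
    rw [Fintype.linearIndependent_iff] at hli
    have := hli ![p.1, p.2.1, p.2.2] (by simpa [Fin.sum_univ_three, hL₀] using hp)
    exact Prod.ext (this 0) (Prod.ext (this 1) (this 2))
  let L : (ℝ × ℝ × ℝ) ≃L[ℝ] EuclideanSpace ℝ (Fin 3) :=
    (LinearEquiv.ofInjectiveOfFinrankEq L₀ hinj (by simp)).toContinuousLinearEquiv
  have hL (p : ℝ × ℝ × ℝ) :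
      L p = p.1 • (a₂ - a₁) + p.2.1 • (a₃ - a₁) + p.2.2 • (a₄ - a₁) := hL₀ p
  let φ : (ℝ × ℝ × ℝ) ≃ₜ EuclideanSpace ℝ (Fin 3) :=
    L.toHomeomorph.trans (Homeomorph.addLeft a₁)
  have hφ (p : ℝ × ℝ × ℝ) :
      φ p = a₁ + (p.1 • (a₂ - a₁) + p.2.1 • (a₃ - a₁) + p.2.2 • (a₄ - a₁)) :=
    congrArg (a₁ + ·) (hL p)
  have himage : convexHull ℝ {a₁, a₂, a₃, a₄} = φ '' cornerTetrahedron := by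
    apply subset_antisymm
    · refine convexHull_min ?_ ?_
      · rintro x (rfl | rfl | rfl | rfl)
        · exact ⟨(0, 0, 0), by simp [cornerTetrahedron], by simp [hφ]⟩
        · exact ⟨(1, 0, 0), by simp [cornerTetrahedron], by simp [hφ]⟩
        · exact ⟨(0, 1, 0), by simp [cornerTetrahedron], by simp [hφ]⟩
        · exact ⟨(0, 0, 1), by simp [cornerTetrahedron], by simp [hφ]⟩
      · have := (convex_cornerTetrahedron.linear_image L.toLinearMap).translate a₁
        rwa [Set.image_image] at this
    · rintro _ ⟨⟨x, y, z⟩, ⟨hx, hy, hz, hxyz⟩, rfl⟩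
      have hmem := (convex_convexHull ℝ {a₁, a₂, a₃, a₄}).sum_mem (t := Finset.univ)
        (w := ![1 - x - y - z, x, y, z]) (z := ![a₁, a₂, a₃, a₄])
        (by
          simp only at hxyz hx hy hz
          intro i _
          fin_cases i <;> simp <;> linarith)
        (by
          simp only [Fin.sum_univ_four, Matrix.cons_val]
          ring)
        (by
          intro i _
          apply subset_convexHull
          fin_cases i <;> simp)
      convert hmem using 1
      simp only [hφ, Fin.sum_univ_four, Matrix.cons_val]
      module
  let ν : Measure (EuclideanSpace ℝ (Fin 3)) := Measure.map L volume
  have hvol : (volume : Measure (ℝ × ℝ × ℝ)).IsAddHaarMeasure :=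
    have : (volume : Measure (ℝ × ℝ)).IsAddHaarMeasure :=
      Measure.prod.instIsAddHaarMeasure volume volume
    Measure.prod.instIsAddHaarMeasure volume volume
  have hν : ν.IsAddHaarMeasure := L.isAddHaarMeasure_map volume
  have hmap : Measure.map φ volume = ν := by
    have : Measure.map (a₁ + ·) ν = ν := map_add_left_eq_self ν a₁
    rw [← this, Measure.map_map (by fun_prop) L.continuous.measurable]
    rfl
  obtain ⟨c, hc⟩ : ∃ c : NNReal, (volume : Measure (EuclideanSpace ℝ (Fin 3))) = c • ν :=
    ⟨_, Measure.isAddLeftInvariant_eq_smul volume ν⟩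
  refine ⟨c, fun f => ?_⟩
  rw [himage, hc, Measure.restrict_smul, integral_smul_nnreal_measure, ← hmap,
    φ.measurableEmbedding.setIntegral_map, φ.injective.preimage_image]
  simp [hφ, NNReal.smul_def]

theorem stmt_0 (a₁ a₂ a₃ a₄ : EuclideanSpace ℝ (Fin 3))
    (h : AffineIndependent ℝ ![a₁, a₂, a₃, a₄]) :
    ∫ x in convexHull ℝ {a₁, a₂, a₃, a₄}, ((x 1) ^ 2 + (x 2) ^ 2) =
      (volume (convexHull ℝ {a₁, a₂, a₃, a₄} : Set (EuclideanSpace ℝ (Fin 3)))).toReal *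
        (a₁ 1 ^ 2 + a₁ 1 * a₂ 1 + a₂ 1 ^ 2 + a₁ 1 * a₃ 1 + a₂ 1 * a₃ 1 + a₃ 1 ^ 2 + a₁ 1 * a₄ 1 + a₂ 1 * a₄ 1 + a₃ 1 * a₄ 1 + a₄ 1 ^ 2 + a₁ 2 ^ 2 + a₁ 2 * a₂ 2 + a₂ 2 ^ 2 + a₁ 2 * a₃ 2 + a₂ 2 * a₃ 2 + a₃ 2 ^ 2 + a₁ 2 * a₄ 2 + a₂ 2 * a₄ 2 + a₃ 2 * a₄ 2 + a₄ 2 ^ 2) / 10 := by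
  obtain ⟨c, hc⟩ := exists_setIntegral_convexHull_eq h
  have hV : (volume (convexHull ℝ {a₁, a₂, a₃, a₄} : Set (EuclideanSpace ℝ (Fin 3)))).toReal =
      c / 6 := by
    have := hc fun _ => 1
    simp only [setIntegral_const, smul_eq_mul, mul_one, volume_real_cornerTetrahedron] at this
    rw [← measureReal_def, this]
    ring
  rw [hV, hc]
  simp only [PiLp.add_apply, PiLp.smul_apply, PiLp.sub_apply, smul_eq_mul]
  rw [integral_add, setIntegral_cornerTetrahedron_sq, setIntegral_cornerTetrahedron_sq]
  · ring
  all_goals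
    refine ContinuousOn.integrableOn_compact isCompact_cornerTetrahedron ?_
    fun_prop
end

section
/- Let a1=(x1,y1,z1), a2=(x2,y2,z2), a3=(x3,y3,z3), a4=(x4,y4,z4) be four affinely independent points in ℝ³, let D be the solid tetrahedron given by their convex hull, and let V be the Lebesgue volume of D. Then ∫_D (x² + y²) dV = V·(x1² + x1x2 + x2² + x1x3 + x2x3 + x3² + x1x4 + x2x4 + x3x4 + x4² + y1² + y1y2 + y2² + y1y3 + y2y3 + y3² + y1y4 + y2y4 + y3y4 + y4²)/10. -/
open MeasureTheory

/-- The standard solid simplex in `ℝ × ℝ × ℝ`, spanned by the origin and the unit vectors. -/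
def solidSimplex : Set (ℝ × ℝ × ℝ) :=
  {p | 0 ≤ p.1 ∧ 0 ≤ p.2.1 ∧ 0 ≤ p.2.2 ∧ p.1 + p.2.1 + p.2.2 ≤ 1}

lemma isClosed_solidSimplex : IsClosed solidSimplex := by
  unfold solidSimplex
  simp only [Set.ofPred_and]
  refine .inter ?_ (.inter ?_ (.inter ?_ ?_)) <;> exact isClosed_le (by fun_prop) (by fun_prop)

lemma isCompact_solidSimplex : IsCompact solidSimplex := by
  refine (isCompact_Icc (a := (0 : ℝ × ℝ × ℝ)) (b := 1)).of_isClosed_subset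
    isClosed_solidSimplex ?_
  rintro ⟨u, v, w⟩ ⟨h1, h2, h3, h4⟩
  dsimp only at h1 h2 h3 h4
  refine ⟨⟨h1, h2, h3⟩, ?_, ?_, ?_⟩ <;> simp <;> linarith

lemma convex_solidSimplex : Convex ℝ solidSimplex := by
  rintro ⟨u, v, w⟩ ⟨h1, h2, h3, h4⟩ ⟨u', v', w'⟩ ⟨k1, k2, k3, k4⟩ s t hs ht hst
  dsimp only at h1 h2 h3 h4 k1 k2 k3 k4
  refine ⟨?_, ?_, ?_, ?_⟩ <;> simp only [Prod.smul_mk, Prod.mk_add_mk, smul_eq_mul]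
  · positivity
  · positivity
  · positivity
  · nlinarith

lemma setIntegral_solidSimplex {f : ℝ × ℝ × ℝ → ℝ} (hf : Continuous f) :
    ∫ p in solidSimplex, f p =
      ∫ u in (0 : ℝ)..1, ∫ v in (0 : ℝ)..1 - u, ∫ w in (0 : ℝ)..1 - u - v, f (u, v, w) := by
  have hm : MeasurableSet solidSimplex := isClosed_solidSimplex.measurableSet
  have hint : Integrable (solidSimplex.indicator f) :=
    (integrable_indicator_iff hm).2 (hf.continuousOn.integrableOn_compact isCompact_solidSimplex)
  rw [← integral_indicator hm, Measure.volume_eq_prod, integral_prod _ hint,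
    intervalIntegral.integral_of_le zero_le_one, ← integral_Icc_eq_integral_Ioc,
    ← integral_indicator measurableSet_Icc]
  refine integral_congr_ae ?_
  filter_upwards [hint.prod_right_ae] with u hu
  rw [Measure.volume_eq_prod, integral_prod _ hu]
  by_cases hu01 : u ∈ Set.Icc (0 : ℝ) 1
  · rw [Set.indicator_of_mem hu01, intervalIntegral.integral_of_le (by linarith [hu01.2]),
      ← integral_Icc_eq_integral_Ioc, ← integral_indicator measurableSet_Icc]
    congr 1 with v
    by_cases hv : v ∈ Set.Icc (0 : ℝ) (1 - u)
    · rw [Set.indicator_of_mem hv, intervalIntegral.integral_of_le (by linarith [hv.2]),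
        ← integral_Icc_eq_integral_Ioc, ← integral_indicator measurableSet_Icc]
      congr 1 with w
      refine Set.indicator_eq_indicator ?_ rfl
      exact ⟨fun ⟨_, _, h3, h4⟩ => ⟨h3, by dsimp only at h4; linarith⟩,
        fun ⟨h3, h4⟩ => ⟨hu01.1, hv.1, h3, by dsimp only; linarith⟩⟩
    · rw [Set.indicator_of_notMem hv]
      refine integral_eq_zero_of_ae (.of_forall fun w => Set.indicator_of_notMem ?_ _)
      rintro ⟨_, h2, h3, h4⟩
      dsimp only at h2 h3 h4
      exact hv ⟨h2, by linarith⟩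
  · rw [Set.indicator_of_notMem hu01]
    refine integral_eq_zero_of_ae (.of_forall fun v =>
      integral_eq_zero_of_ae (.of_forall fun w => Set.indicator_of_notMem ?_ _))
    rintro ⟨h1, h2, h3, h4⟩
    dsimp only at h1 h2 h3 h4
    exact hu01 ⟨h1, by linarith⟩

lemma integral_quartic (c₀ c₁ c₂ c₃ c₄ s : ℝ) :
    ∫ x in (0 : ℝ)..s, (c₀ + c₁ * x + c₂ * x ^ 2 + c₃ * x ^ 3 + c₄ * x ^ 4) =
      c₀ * s + c₁ * s ^ 2 / 2 + c₂ * s ^ 3 / 3 + c₃ * s ^ 4 / 4 + c₄ * s ^ 5 / 5 := by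
  have hd : ∀ x ∈ Set.uIcc 0 s, HasDerivAt
      (fun x : ℝ => c₀ * x + c₁ * x ^ 2 / 2 + c₂ * x ^ 3 / 3 + c₃ * x ^ 4 / 4 + c₄ * x ^ 5 / 5)
      (c₀ + c₁ * x + c₂ * x ^ 2 + c₃ * x ^ 3 + c₄ * x ^ 4) x := by
    intro x _
    have h := (((((hasDerivAt_id x).const_mul c₀).add
      (((hasDerivAt_pow 2 x).const_mul c₁).div_const 2)).add
      (((hasDerivAt_pow 3 x).const_mul c₂).div_const 3)).add
      (((hasDerivAt_pow 4 x).const_mul c₃).div_const 4)).add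
      (((hasDerivAt_pow 5 x).const_mul c₄).div_const 5)
    refine h.congr_deriv ?_
    norm_num
    ring
  rw [intervalIntegral.integral_eq_sub_of_hasDerivAt hd
    (Continuous.intervalIntegrable (by fun_prop) _ _)]
  ring

lemma setIntegral_solidSimplex_affine_sq (A B C D : ℝ) :
    ∫ p in solidSimplex, (A + p.1 * B + p.2.1 * C + p.2.2 * D) ^ 2 =
      (A ^ 2 + (A + B) ^ 2 + (A + C) ^ 2 + (A + D) ^ 2 + A * (A + B) + A * (A + C) + A * (A + D)
        + (A + B) * (A + C) + (A + B) * (A + D) + (A + C) * (A + D)) / 60 := by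
  have inner (P t v : ℝ) : ∫ w in (0 : ℝ)..t - v, (P + v * C + w * D) ^ 2 =
      (P ^ 2 * t + D * P * t ^ 2 + D ^ 2 * t ^ 3 / 3)
        + (-P ^ 2 + 2 * P * C * t - 2 * D * P * t + D * C * t ^ 2 - D ^ 2 * t ^ 2) * v
        + (-2 * P * C + C ^ 2 * t + D * P - 2 * D * C * t + D ^ 2 * t) * v ^ 2
        + (-C ^ 2 + D * C - D ^ 2 / 3) * v ^ 3 + 0 * v ^ 4 := by
    convert integral_quartic ((P + v * C) ^ 2) (2 * (P + v * C) * D) (D ^ 2) 0 0 (t - v) using 1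
    · congr 1 with w
      ring
    · ring
  have middle (u : ℝ) : ∫ v in (0 : ℝ)..1 - u, ∫ w in (0 : ℝ)..1 - u - v,
      (A + u * B + v * C + w * D) ^ 2 =
      (A ^ 2 / 2 + A * (C + D) / 3 + (C ^ 2 + C * D + D ^ 2) / 12)
        + (A * B - A ^ 2 + (B - 3 * A) * (C + D) / 3 - (C ^ 2 + C * D + D ^ 2) / 3) * u
        + (B ^ 2 / 2 - 2 * A * B + A ^ 2 / 2 + (A - B) * (C + D)
          + (C ^ 2 + C * D + D ^ 2) / 2) * u ^ 2
        + (A * B - B ^ 2 + (3 * B - A) * (C + D) / 3 - (C ^ 2 + C * D + D ^ 2) / 3) * u ^ 3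
        + (B ^ 2 / 2 - B * (C + D) / 3 + (C ^ 2 + C * D + D ^ 2) / 12) * u ^ 4 := by
    simp_rw [inner (A + u * B) (1 - u), integral_quartic]
    ring
  rw [setIntegral_solidSimplex (by fun_prop)]
  simp_rw [middle, integral_quartic]
  ring

lemma integrableOn_solidSimplex_affine_sq (A B C D : ℝ) :
    IntegrableOn (fun p : ℝ × ℝ × ℝ => (A + p.1 * B + p.2.1 * C + p.2.2 * D) ^ 2)
      solidSimplex :=
  (by fun_prop : Continuous _).continuousOn.integrableOn_compact isCompact_solidSimplex

lemma measureReal_solidSimplex : volume.real solidSimplex = 1 / 6 := by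
  have h := setIntegral_solidSimplex_affine_sq 1 0 0 0
  norm_num at h
  exact h

section

variable {E : Type*} [AddCommGroup E] [Module ℝ E]

/-- The linear map sending the standard basis vectors to `e₁`, `e₂`, `e₃`. -/
def tripleCombination (e₁ e₂ e₃ : E) : ℝ × ℝ × ℝ →ₗ[ℝ] E where
  toFun p := p.1 • e₁ + p.2.1 • e₂ + p.2.2 • e₃
  map_add' p q := by simp only [Prod.fst_add, Prod.snd_add]; module
  map_smul' c p := by
    simp only [Prod.smul_fst, Prod.smul_snd, smul_eq_mul, RingHom.id_apply]; module

lemma convexHull_eq_image_solidSimplex (a₁ a₂ a₃ a₄ : E) :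
    convexHull ℝ {a₁, a₂, a₃, a₄} =
      (fun p => a₁ + tripleCombination (a₂ - a₁) (a₃ - a₁) (a₄ - a₁) p) '' solidSimplex := by
  apply subset_antisymm
  · refine convexHull_min ?_ ?_
    · rintro x (rfl | rfl | rfl | rfl)
      · exact ⟨(0, 0, 0), by simp [solidSimplex], by simp [tripleCombination]⟩
      · exact ⟨(1, 0, 0), by simp [solidSimplex], by simp [tripleCombination]⟩
      · exact ⟨(0, 1, 0), by simp [solidSimplex], by simp [tripleCombination]⟩
      · exact ⟨(0, 0, 1), by simp [solidSimplex], by simp [tripleCombination]⟩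
    · have h := (convex_solidSimplex.linear_image
        (tripleCombination (a₂ - a₁) (a₃ - a₁) (a₄ - a₁))).translate a₁
      rwa [Set.image_image] at h
  · rintro _ ⟨⟨u, v, w⟩, ⟨h1, h2, h3, h4⟩, rfl⟩
    dsimp only at h1 h2 h3 h4
    have h := (convex_convexHull ℝ {a₁, a₂, a₃, a₄}).sum_mem (t := Finset.univ)
      (w := ![1 - u - v - w, u, v, w]) (z := ![a₁, a₂, a₃, a₄]) ?_ ?_ ?_
    · convert h using 1
      simp only [tripleCombination, LinearMap.coe_mk, AddHom.coe_mk, Fin.sum_univ_four,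
        Matrix.cons_val]
      module
    · intro i _
      fin_cases i <;> simp <;> linarith
    · simp only [Fin.sum_univ_four, Matrix.cons_val]
      ring
    · intro i _
      apply subset_convexHull
      fin_cases i <;> simp

lemma tripleCombination_injective {a₁ a₂ a₃ a₄ : E}
    (h : AffineIndependent ℝ ![a₁, a₂, a₃, a₄]) :
    Function.Injective (tripleCombination (a₂ - a₁) (a₃ - a₁) (a₄ - a₁)) := by
  rw [injective_iff_map_eq_zero]
  rintro ⟨u, v, w⟩ huvw
  simp only [tripleCombination, LinearMap.coe_mk, AddHom.coe_mk] at huvw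
  rw [affineIndependent_iff] at h
  have key := h Finset.univ ![-u - v - w, u, v, w]
    (by
      simp only [Fin.sum_univ_four, Matrix.cons_val]
      ring)
    (by
      simp only [Fin.sum_univ_four, Matrix.cons_val]
      rw [← huvw]
      module)
  have hu := key 1 (Finset.mem_univ _)
  have hv := key 2 (Finset.mem_univ _)
  have hw := key 3 (Finset.mem_univ _)
  simp only [Matrix.cons_val] at hu hv hw
  simp [hu, hv, hw]

end

/-- The integral over a tetrahedron is, up to the constant `6 * volume`, the integral over the
standard simplex of the pullback under barycentric parametrization. -/
lemma setIntegral_convexHull_eq_solidSimplex {E : Type*} [NormedAddCommGroup E]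
    [NormedSpace ℝ E] [FiniteDimensional ℝ E] [MeasurableSpace E] [BorelSpace E]
    (μ : Measure E) [μ.IsAddHaarMeasure] (hE : Module.finrank ℝ E = 3) {a₁ a₂ a₃ a₄ : E}
    (h : AffineIndependent ℝ ![a₁, a₂, a₃, a₄]) (f : E → ℝ) :
    ∫ x in convexHull ℝ {a₁, a₂, a₃, a₄}, f x ∂μ =
      μ.real (convexHull ℝ {a₁, a₂, a₃, a₄}) * 6 *
        ∫ p in solidSimplex,
          f (a₁ + tripleCombination (a₂ - a₁) (a₃ - a₁) (a₄ - a₁) p) := by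
  have hinj := tripleCombination_injective h
  let L : (ℝ × ℝ × ℝ) ≃L[ℝ] E :=
    (LinearEquiv.ofInjectiveOfFinrankEq _ hinj (by simp [hE])).toContinuousLinearEquiv
  let ψ : (ℝ × ℝ × ℝ) ≃ₜ E := L.toHomeomorph.trans (Homeomorph.addLeft a₁)
  have hψ (p) : ψ p = a₁ + tripleCombination (a₂ - a₁) (a₃ - a₁) (a₄ - a₁) p := rfl
  have : (volume : Measure (ℝ × ℝ × ℝ)).IsAddHaarMeasure := by
    have : (volume : Measure (ℝ × ℝ)).IsAddHaarMeasure :=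
      Measure.prod.instIsAddHaarMeasure volume volume
    exact Measure.prod.instIsAddHaarMeasure volume volume
  have := L.isAddHaarMeasure_map volume
  obtain ⟨c, hc⟩ : ∃ c : NNReal, μ = c • Measure.map ψ volume := by
    refine ⟨μ.addHaarScalarFactor (Measure.map L volume), ?_⟩
    have h1 : Measure.map ψ volume = Measure.map L volume := by
      rw [← map_add_left_eq_self (Measure.map L volume) a₁,
        Measure.map_map (by fun_prop) L.continuous.measurable]
      rfl
    rw [h1]
    exact Measure.isAddLeftInvariant_eq_smul _ _
  have hpre : ψ ⁻¹' convexHull ℝ {a₁, a₂, a₃, a₄} = solidSimplex := by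
    rw [convexHull_eq_image_solidSimplex]
    exact ψ.injective.preimage_image _
  have hint : ∫ x in convexHull ℝ {a₁, a₂, a₃, a₄}, f x ∂μ =
      c * ∫ p in solidSimplex, f (ψ p) := by
    rw [hc, Measure.restrict_smul, integral_smul_nnreal_measure,
      ψ.measurableEmbedding.setIntegral_map, hpre]
    rfl
  have hvol : μ.real (convexHull ℝ {a₁, a₂, a₃, a₄}) = c * (1 / 6) := by
    rw [hc, measureReal_nnreal_smul_apply, measureReal_def, ψ.measurableEmbedding.map_apply, hpre,
      ← measureReal_def, measureReal_solidSimplex]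
  rw [hint, hvol]
  simp_rw [hψ]
  ring

theorem stmt_2 (a₁ a₂ a₃ a₄ : EuclideanSpace ℝ (Fin 3))
    (h : AffineIndependent ℝ ![a₁, a₂, a₃, a₄]) :
    ∫ x in convexHull ℝ {a₁, a₂, a₃, a₄}, ((x 0) ^ 2 + (x 1) ^ 2) =
      (volume (convexHull ℝ {a₁, a₂, a₃, a₄} : Set (EuclideanSpace ℝ (Fin 3)))).toReal *
        (a₁ 0 ^ 2 + a₁ 0 * a₂ 0 + a₂ 0 ^ 2 + a₁ 0 * a₃ 0 + a₂ 0 * a₃ 0 + a₃ 0 ^ 2 + a₁ 0 * a₄ 0 + a₂ 0 * a₄ 0 + a₃ 0 * a₄ 0 + a₄ 0 ^ 2 + a₁ 1 ^ 2 + a₁ 1 * a₂ 1 + a₂ 1 ^ 2 + a₁ 1 * a₃ 1 + a₂ 1 * a₃ 1 + a₃ 1 ^ 2 + a₁ 1 * a₄ 1 + a₂ 1 * a₄ 1 + a₃ 1 * a₄ 1 + a₄ 1 ^ 2) / 10 := by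
  rw [setIntegral_convexHull_eq_solidSimplex volume (by simp) h]
  have hcoord (p : ℝ × ℝ × ℝ) (i : Fin 3) :
      (a₁ + tripleCombination (a₂ - a₁) (a₃ - a₁) (a₄ - a₁) p) i =
        a₁ i + p.1 * (a₂ i - a₁ i) + p.2.1 * (a₃ i - a₁ i) + p.2.2 * (a₄ i - a₁ i) := by
    simp [tripleCombination]
    ring
  simp_rw [hcoord]
  rw [integral_add (integrableOn_solidSimplex_affine_sq _ _ _ _)
    (integrableOn_solidSimplex_affine_sq _ _ _ _), setIntegral_solidSimplex_affine_sq,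
    setIntegral_solidSimplex_affine_sq, measureReal_def]
  ring
end

section
/- Let a1=(x1,y1,z1), a2=(x2,y2,z2), a3=(x3,y3,z3), a4=(x4,y4,z4) be four affinely independent points in ℝ³, let D be the solid tetrahedron given by their convex hull, and let V be the Lebesgue volume of D. Then ∫_D yz dV = V·(2y1z1 + y2z1 + y3z1 + y4z1 + y1z2 + 2y2z2 + y3z2 + y4z2 + y1z3 + y2z3 + 2y3z3 + y4z3 + y1z4 + y2z4 + y3z4 + 2y4z4)/20. -/
open MeasureTheory

theorem setIntegral_prod_fiber {β : Type*} [MeasureSpace β] [SFinite (volume : Measure β)]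
    {A : Set ℝ} {B : ℝ → Set β} {S : Set (ℝ × β)} (hS : MeasurableSet S) (hA : MeasurableSet A)
    (hB : ∀ x, MeasurableSet (B x)) (hmem : ∀ x y, (x, y) ∈ S ↔ x ∈ A ∧ y ∈ B x)
    {f : ℝ × β → ℝ} (hf : IntegrableOn f S) :
    ∫ z in S, f z = ∫ x in A, ∫ y in B x, f (x, y) := by
  classical
  rw [← integral_indicator hS, Measure.volume_eq_prod,
    integral_prod _ ((integrable_indicator_iff hS).2 hf), ← integral_indicator hA]
  congr 1 with x
  by_cases hx : x ∈ A
  · rw [Set.indicator_of_mem hx, ← integral_indicator (hB x)]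
    congr 1 with y
    simp [Set.indicator, hmem, hx]
  · rw [Set.indicator_of_notMem hx]
    simp [Set.indicator, hmem, hx]

theorem integral_quartic_s3 (a b c d e t : ℝ) :
    ∫ x in (0 : ℝ)..t, (a + b * x + c * x ^ 2 + d * x ^ 3 + e * x ^ 4) =
      a * t + b * t ^ 2 / 2 + c * t ^ 3 / 3 + d * t ^ 4 / 4 + e * t ^ 5 / 5 := by
  have h : ∀ x ∈ Set.uIcc 0 t, HasDerivAt
      (fun t : ℝ => a * t + b * t ^ 2 / 2 + c * t ^ 3 / 3 + d * t ^ 4 / 4 + e * t ^ 5 / 5)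
      (a + b * x + c * x ^ 2 + d * x ^ 3 + e * x ^ 4) x := by
    intro x _
    have hp (n : ℕ) := hasDerivAt_pow n x
    refine HasDerivAt.congr_deriv ((((((hasDerivAt_id x).const_mul a).add
      (((hp 2).const_mul b).div_const 2)).add (((hp 3).const_mul c).div_const 3)).add
      (((hp 4).const_mul d).div_const 4)).add (((hp 5).const_mul e).div_const 5)) ?_
    push_cast
    ring
  rw [intervalIntegral.integral_eq_sub_of_hasDerivAt h
    (Continuous.intervalIntegrable (by fun_prop) _ _)]
  ring

/-- The corner of the unit cube in `ℝ³` cut off by the plane `p + q + r = 1`. -/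
def cornerSimplex : Set (ℝ × ℝ × ℝ) :=
  {w | 0 ≤ w.1 ∧ 0 ≤ w.2.1 ∧ 0 ≤ w.2.2 ∧ w.1 + w.2.1 + w.2.2 ≤ 1}

theorem isCompact_cornerSimplex : IsCompact cornerSimplex := by
  refine (isCompact_Icc (a := ((0, 0, 0) : ℝ × ℝ × ℝ)) (b := (1, 1, 1))).of_isClosed_subset ?_ ?_
  · simp only [cornerSimplex, Set.ofPred_and]
    refine (isClosed_le ?_ ?_).inter ((isClosed_le ?_ ?_).inter ((isClosed_le ?_ ?_).inter
      (isClosed_le ?_ ?_))) <;> fun_prop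
  · rintro ⟨p, q, r⟩ ⟨h1, h2, h3, h4⟩
    simp only at h1 h2 h3 h4
    refine ⟨⟨h1, h2, h3⟩, ⟨?_, ?_, ?_⟩⟩ <;> dsimp only <;> linarith

theorem convex_cornerSimplex : Convex ℝ cornerSimplex := by
  rintro ⟨p, q, r⟩ ⟨h1, h2, h3, h4⟩ ⟨p', q', r'⟩ ⟨k1, k2, k3, k4⟩ s t hs ht hst
  simp only at h1 h2 h3 h4 k1 k2 k3 k4
  refine ⟨?_, ?_, ?_, ?_⟩ <;> simp
  · positivity
  · positivity
  · positivity
  · nlinarith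

theorem setIntegral_cornerSimplex {f : ℝ × ℝ × ℝ → ℝ} (hf : Continuous f) :
    ∫ w in cornerSimplex, f w = ∫ p in (0 : ℝ)..1, ∫ q in (0 : ℝ)..(1 - p),
      ∫ r in (0 : ℝ)..(1 - p - q), f (p, q, r) := by
  have hT := isCompact_cornerSimplex
  let B : ℝ → Set (ℝ × ℝ) := fun p => {w | 0 ≤ w.1 ∧ 0 ≤ w.2 ∧ p + w.1 + w.2 ≤ 1}
  have hBcl (p : ℝ) : IsClosed (B p) := by
    simp only [B, Set.ofPred_and]
    refine (isClosed_le ?_ ?_).inter ((isClosed_le ?_ ?_).inter (isClosed_le ?_ ?_)) <;> fun_prop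
  have hB (p : ℝ) : IsCompact (B p) := by
    refine (isCompact_Icc (a := ((0, 0) : ℝ × ℝ)) (b := (1 - p, 1 - p))).of_isClosed_subset
      (hBcl p) ?_
    rintro ⟨q, r⟩ ⟨h2, h3, h4⟩
    simp only at h2 h3 h4
    refine ⟨⟨h2, h3⟩, ⟨?_, ?_⟩⟩ <;> dsimp only <;> linarith
  rw [setIntegral_prod_fiber (A := Set.Icc 0 1) (B := B) hT.measurableSet measurableSet_Icc
    (fun p => (hB p).measurableSet) ?_ (hf.continuousOn.integrableOn_compact hT),
    intervalIntegral.integral_of_le zero_le_one, ← integral_Icc_eq_integral_Ioc]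
  · refine setIntegral_congr_fun measurableSet_Icc fun p hp => ?_
    rw [setIntegral_prod_fiber (A := Set.Icc 0 (1 - p)) (B := fun q => Set.Icc 0 (1 - p - q))
      (hB p).measurableSet measurableSet_Icc (fun _ => measurableSet_Icc) ?_
      ((by fun_prop : Continuous fun w : ℝ × ℝ => f (p, w)).continuousOn.integrableOn_compact
        (hB p)), intervalIntegral.integral_of_le (by linarith [hp.2]),
        ← integral_Icc_eq_integral_Ioc]
    · refine setIntegral_congr_fun measurableSet_Icc fun q hq => ?_
      rw [intervalIntegral.integral_of_le (by linarith [hq.2]), integral_Icc_eq_integral_Ioc]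
    · intro q r
      simp only [B, Set.mem_ofPred_eq, Set.mem_Icc]
      constructor
      · rintro ⟨h1, h2, h3⟩
        refine ⟨⟨?_, ?_⟩, ?_, ?_⟩ <;> linarith
      · rintro ⟨⟨h1, h2⟩, h3, h4⟩
        refine ⟨?_, ?_, ?_⟩ <;> linarith
  · rintro p ⟨q, r⟩
    simp only [cornerSimplex, B, Set.mem_ofPred_eq, Set.mem_Icc]
    constructor
    · rintro ⟨h1, h2, h3, h4⟩
      refine ⟨⟨?_, ?_⟩, ?_, ?_, ?_⟩ <;> linarith
    · rintro ⟨⟨h1, h2⟩, h3, h4, h5⟩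
      refine ⟨?_, ?_, ?_, ?_⟩ <;> linarith

theorem setIntegral_cornerSimplex_mul_affine (b₀ b₁ b₂ b₃ c₀ c₁ c₂ c₃ : ℝ) :
    ∫ w in cornerSimplex, (b₀ + w.1 * b₁ + w.2.1 * b₂ + w.2.2 * b₃) *
        (c₀ + w.1 * c₁ + w.2.1 * c₂ + w.2.2 * c₃) =
      b₀ * c₀ / 6 + (b₀ * (c₁ + c₂ + c₃) + (b₁ + b₂ + b₃) * c₀) / 24 +
        ((b₁ + b₂ + b₃) * (c₁ + c₂ + c₃) + b₁ * c₁ + b₂ * c₂ + b₃ * c₃) / 120 := by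
  rw [setIntegral_cornerSimplex (by fun_prop)]
  have hr (p q : ℝ) : ∫ r in (0 : ℝ)..(1 - p - q), (b₀ + p * b₁ + q * b₂ + r * b₃) *
        (c₀ + p * c₁ + q * c₂ + r * c₃) =
      (b₀ + p * b₁ + q * b₂) * (c₀ + p * c₁ + q * c₂) * (1 - p - q) +
      ((b₀ + p * b₁ + q * b₂) * c₃ + b₃ * (c₀ + p * c₁ + q * c₂)) * (1 - p - q) ^ 2 / 2 +
      b₃ * c₃ * (1 - p - q) ^ 3 / 3 := by
    convert integral_quartic_s3 ((b₀ + p * b₁ + q * b₂) * (c₀ + p * c₁ + q * c₂))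
      ((b₀ + p * b₁ + q * b₂) * c₃ + b₃ * (c₀ + p * c₁ + q * c₂)) (b₃ * c₃) 0 0 (1 - p - q)
      using 1
    · congr 1 with r
      ring
    · ring
  have hq (p : ℝ) : ∫ q in (0 : ℝ)..(1 - p),
      ((b₀ + p * b₁ + q * b₂) * (c₀ + p * c₁ + q * c₂) * (1 - p - q) +
      ((b₀ + p * b₁ + q * b₂) * c₃ + b₃ * (c₀ + p * c₁ + q * c₂)) * (1 - p - q) ^ 2 / 2 +
      b₃ * c₃ * (1 - p - q) ^ 3 / 3) =
      (b₀ + p * b₁) * (c₀ + p * c₁) * (1 - p) ^ 2 / 2 +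
      ((b₀ + p * b₁) * (c₂ + c₃) + (b₂ + b₃) * (c₀ + p * c₁)) * (1 - p) ^ 3 / 6 +
      (2 * b₂ * c₂ + 2 * b₃ * c₃ + b₂ * c₃ + b₃ * c₂) * (1 - p) ^ 4 / 24 := by
    generalize b₀ + p * b₁ = X
    generalize c₀ + p * c₁ = Y
    generalize 1 - p = s
    convert integral_quartic_s3 (X * Y * s + (X * c₃ + b₃ * Y) * s ^ 2 / 2 + b₃ * c₃ * s ^ 3 / 3)
      ((X * c₂ + b₂ * Y) * s - X * Y + (b₂ * c₃ + b₃ * c₂) * s ^ 2 / 2 - (X * c₃ + b₃ * Y) * s -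
        b₃ * c₃ * s ^ 2)
      (b₃ * c₃ * s - b₂ * Y - X * c₂ + b₂ * c₂ * s + (X * c₃ + b₃ * Y) / 2 -
        (b₂ * c₃ + b₃ * c₂) * s)
      ((b₂ * c₃ + b₃ * c₂) / 2 - b₂ * c₂ - b₃ * c₃ / 3) 0 s using 1
    · congr 1 with q
      ring
    · ring
  simp only [hr, hq]
  let g : ℝ → ℝ := fun u => 0 + 0 * u + (b₀ + b₁) * (c₀ + c₁) / 2 * u ^ 2 +
    (((b₀ + b₁) * (c₂ + c₃) + (b₂ + b₃) * (c₀ + c₁)) / 6 -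
      (b₁ * (c₀ + c₁) + (b₀ + b₁) * c₁) / 2) * u ^ 3 +
    (b₁ * c₁ / 2 - (b₁ * (c₂ + c₃) + (b₂ + b₃) * c₁) / 6 +
      (2 * b₂ * c₂ + 2 * b₃ * c₃ + b₂ * c₃ + b₃ * c₂) / 24) * u ^ 4
  have hg := intervalIntegral.integral_comp_sub_left (a := 0) (b := 1) g 1
  rw [sub_self, sub_zero, integral_quartic_s3] at hg
  convert hg using 1
  · congr 1 with p
    simp only [g]
    ring
  · ring

/-- An affinely parametrized integral over a set `T` scales by the same factor for every
integrand. -/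
theorem exists_setIntegral_affine_image {E F : Type*}
    [NormedAddCommGroup E] [NormedSpace ℝ E] [FiniteDimensional ℝ E] [MeasureSpace E]
    [BorelSpace E] [(volume : Measure E).IsAddHaarMeasure]
    [NormedAddCommGroup F] [NormedSpace ℝ F] [FiniteDimensional ℝ F] [MeasureSpace F]
    [BorelSpace F] [(volume : Measure F).IsAddHaarMeasure]
    (L : E ≃L[ℝ] F) (a : F) (T : Set E) :
    ∃ c : ℝ, ∀ f : F → ℝ, ∫ x in (fun w => a + L w) '' T, f x = c * ∫ w in T, f (a + L w) := by
  let e : E ≃ₜ F := L.toHomeomorph.trans (Homeomorph.addLeft a)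
  have : ((volume : Measure E).map L).IsAddHaarMeasure := L.isAddHaarMeasure_map _
  have hmap : (volume : Measure E).map e = (volume : Measure E).map L := by
    have h1 : (e : E → F) = (fun x => a + x) ∘ L := rfl
    rw [h1, ← Measure.map_map (by fun_prop) L.continuous.measurable, map_add_left_eq_self]
  obtain ⟨c, hvol⟩ : ∃ c : NNReal, (volume : Measure F) = c • (volume : Measure E).map L :=
    ⟨_, Measure.isAddLeftInvariant_eq_smul _ _⟩
  refine ⟨c, fun f => ?_⟩
  have himg : (fun w => a + L w) '' T = e '' T := rfl
  rw [hvol, himg, Measure.restrict_smul, integral_smul_nnreal_measure, ← hmap,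
    e.measurableEmbedding.setIntegral_map, Set.preimage_image_eq _ e.injective]
  rfl

theorem image_cornerSimplex {E : Type*} [AddCommGroup E] [Module ℝ E] (a₁ a₂ a₃ a₄ : E)
    (L : ℝ × ℝ × ℝ →ₗ[ℝ] E)
    (hL : ∀ w, L w = w.1 • (a₂ - a₁) + w.2.1 • (a₃ - a₁) + w.2.2 • (a₄ - a₁)) :
    (fun w => a₁ + L w) '' cornerSimplex = convexHull ℝ {a₁, a₂, a₃, a₄} := by
  apply Set.Subset.antisymm
  · rintro _ ⟨⟨p, q, r⟩, ⟨h1, h2, h3, h4⟩, rfl⟩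
    simp only at h1 h2 h3 h4
    have hsum := (convex_convexHull ℝ {a₁, a₂, a₃, a₄}).sum_mem (t := Finset.univ)
      (w := ![1 - p - q - r, p, q, r]) (z := ![a₁, a₂, a₃, a₄]) ?_ ?_ ?_
    · convert hsum using 1
      simp only [hL, Fin.sum_univ_four]
      simp
      module
    · intro i _
      fin_cases i <;> simp <;> linarith
    · simp [Fin.sum_univ_four]
      ring
    · intro i _
      apply subset_convexHull
      fin_cases i <;> simp
  · refine convexHull_min ?_ ?_
    · rintro x (rfl | rfl | rfl | rfl)
      · exact ⟨(0, 0, 0), by simp [cornerSimplex], by simp [hL]⟩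
      · exact ⟨(1, 0, 0), by simp [cornerSimplex], by simp [hL]⟩
      · exact ⟨(0, 1, 0), by simp [cornerSimplex], by simp [hL]⟩
      · exact ⟨(0, 0, 1), by simp [cornerSimplex], by simp [hL]⟩
    · have := (convex_cornerSimplex.linear_image L).translate a₁
      rwa [Set.image_image] at this

theorem exists_continuousLinearEquiv_of_affineIndependent (a₁ a₂ a₃ a₄ : EuclideanSpace ℝ (Fin 3))
    (h : AffineIndependent ℝ ![a₁, a₂, a₃, a₄]) :
    ∃ L : (ℝ × ℝ × ℝ) ≃L[ℝ] EuclideanSpace ℝ (Fin 3),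
      ∀ w, L w = w.1 • (a₂ - a₁) + w.2.1 • (a₃ - a₁) + w.2.2 • (a₄ - a₁) := by
  let f : ℝ × ℝ × ℝ →ₗ[ℝ] EuclideanSpace ℝ (Fin 3) :=
    (LinearMap.toSpanSingleton ℝ _ (a₂ - a₁)).coprod
      ((LinearMap.toSpanSingleton ℝ _ (a₃ - a₁)).coprod
        (LinearMap.toSpanSingleton ℝ _ (a₄ - a₁)))
  have hf (w) : f w = w.1 • (a₂ - a₁) + w.2.1 • (a₃ - a₁) + w.2.2 • (a₄ - a₁) := by
    simp [f, add_assoc]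
  have hinj : Function.Injective f := by
    rw [← LinearMap.ker_eq_bot, LinearMap.ker_eq_bot']
    rintro ⟨p, q, r⟩ hw
    rw [hf] at hw
    have hz := affineIndependent_iff.1 h Finset.univ ![-(p + q + r), p, q, r]
      (by simp [Fin.sum_univ_four]; ring)
      (by
        rw [← hw]
        simp [Fin.sum_univ_four]
        module)
    have h1 := hz 1 (Finset.mem_univ _)
    have h2 := hz 2 (Finset.mem_univ _)
    have h3 := hz 3 (Finset.mem_univ _)
    simp at h1 h2 h3
    simp [h1, h2, h3]
  exact ⟨(LinearEquiv.ofInjectiveOfFinrankEq f hinj (by simp)).toContinuousLinearEquiv, hf⟩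

theorem stmt_3 (a₁ a₂ a₃ a₄ : EuclideanSpace ℝ (Fin 3))
    (h : AffineIndependent ℝ ![a₁, a₂, a₃, a₄]) :
    ∫ x in convexHull ℝ {a₁, a₂, a₃, a₄}, (x 1 * x 2) =
      (volume (convexHull ℝ {a₁, a₂, a₃, a₄} : Set (EuclideanSpace ℝ (Fin 3)))).toReal *
        (2 * a₁ 1 * a₁ 2 + a₂ 1 * a₁ 2 + a₃ 1 * a₁ 2 + a₄ 1 * a₁ 2 + a₁ 1 * a₂ 2 + 2 * a₂ 1 * a₂ 2 + a₃ 1 * a₂ 2 + a₄ 1 * a₂ 2 + a₁ 1 * a₃ 2 + a₂ 1 * a₃ 2 + 2 * a₃ 1 * a₃ 2 + a₄ 1 * a₃ 2 + a₁ 1 * a₄ 2 + a₂ 1 * a₄ 2 + a₃ 1 * a₄ 2 + 2 * a₄ 1 * a₄ 2) / 20 := by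
  obtain ⟨L, hL⟩ := exists_continuousLinearEquiv_of_affineIndependent a₁ a₂ a₃ a₄ h
  have : (volume : Measure (ℝ × ℝ × ℝ)).IsAddHaarMeasure :=
    have : (volume : Measure (ℝ × ℝ)).IsAddHaarMeasure :=
      Measure.prod.instIsAddHaarMeasure volume volume
    Measure.prod.instIsAddHaarMeasure volume volume
  obtain ⟨c, hc⟩ := exists_setIntegral_affine_image L a₁ cornerSimplex
  have himg : (fun w => a₁ + L w) '' cornerSimplex = convexHull ℝ {a₁, a₂, a₃, a₄} :=
    image_cornerSimplex a₁ a₂ a₃ a₄ L.toLinearMap hL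
  rw [himg] at hc
  have hvol : (volume (convexHull ℝ {a₁, a₂, a₃, a₄} : Set (EuclideanSpace ℝ (Fin 3)))).toReal =
      c * (1 / 6) := by
    have h1 := hc fun _ => 1
    have h2 := setIntegral_cornerSimplex_mul_affine 1 0 0 0 1 0 0 0
    norm_num at h1 h2
    rw [h2] at h1
    simpa [Measure.real] using h1
  have hint := setIntegral_cornerSimplex_mul_affine (a₁ 1) (a₂ 1 - a₁ 1) (a₃ 1 - a₁ 1)
    (a₄ 1 - a₁ 1) (a₁ 2) (a₂ 2 - a₁ 2) (a₃ 2 - a₁ 2) (a₄ 2 - a₁ 2)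
  rw [hvol, hc fun x => x 1 * x 2]
  simp only [hL, PiLp.add_apply, PiLp.smul_apply, PiLp.sub_apply, smul_eq_mul, ← add_assoc]
  rw [hint]
  ring
end

section
/- Let 0 < I1 < I2 < I3 be real numbers and ω0 ≠ 0 a real number. Consider the torque-free Euler vector field in principal axes, F : ℝ³ → ℝ³, F(ω1, ω2, ω3) = ( ((I2 − I3)/I1)·ω2·ω3, ((I3 − I1)/I2)·ω3·ω1, ((I1 − I2)/I3)·ω1·ω2 ). Then the Jacobian (total derivative) of F at the equilibrium point (0, ω0, 0) is a linear map of ℝ³ having the strictly positive real eigenvalue λ = |ω0|·√((I2 − I1)(I3 − I2)/(I1·I3)); in particular, rotation about the intermediate principal axis is linearly unstable. -/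
/-- The derivative at `(0, ω₀, 0)` of the Euler-type field
`(a ω₂ ω₃, b ω₃ ω₁, c ω₁ ω₂)`, evaluated on a vector. -/
theorem fderiv_euler_apply (a b c ω₀ : ℝ) (v : Fin 3 → ℝ) :
    fderiv ℝ (fun ω : Fin 3 → ℝ => ![a * ω 1 * ω 2, b * ω 2 * ω 0, c * ω 0 * ω 1])
      ![0, ω₀, 0] v = ![a * ω₀ * v 2, 0, c * ω₀ * v 0] := by
  have h (i : Fin 3) : HasFDerivAt (fun ω : Fin 3 → ℝ => ω i)
      (ContinuousLinearMap.proj (R := ℝ) (φ := fun _ : Fin 3 => ℝ) i) ![0, ω₀, 0] :=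
    hasFDerivAt_apply i _
  have hmul (k : ℝ) (i j : Fin 3) := ((h i).const_mul k).mul (h j)
  have hF : DifferentiableAt ℝ
      (fun ω : Fin 3 → ℝ => ![a * ω 1 * ω 2, b * ω 2 * ω 0, c * ω 0 * ω 1]) ![0, ω₀, 0] := by
    rw [differentiableAt_pi]
    intro i
    fin_cases i
    exacts [(hmul a 1 2).differentiableAt, (hmul b 2 0).differentiableAt,
      (hmul c 0 1).differentiableAt]
  have hcoord := hasFDerivAt_pi'.1 hF.hasFDerivAt
  ext i
  fin_cases i
  · simpa using DFunLike.congr_fun ((hcoord 0).unique (hmul a 1 2)) v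
  · simpa using DFunLike.congr_fun ((hcoord 1).unique (hmul b 2 0)) v
  · simpa [mul_assoc, mul_comm, mul_left_comm] using
      DFunLike.congr_fun ((hcoord 2).unique (hmul c 0 1)) v

theorem stmt_11 (I₁ I₂ I₃ ω₀ : ℝ)
    (h₀ : 0 < I₁) (h₁₂ : I₁ < I₂) (h₂₃ : I₂ < I₃) (hω₀ : ω₀ ≠ 0)
    (F : (Fin 3 → ℝ) → (Fin 3 → ℝ))
    (hF : ∀ ω : Fin 3 → ℝ, F ω =
      ![((I₂ - I₃) / I₁) * ω 1 * ω 2,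
        ((I₃ - I₁) / I₂) * ω 2 * ω 0,
        ((I₁ - I₂) / I₃) * ω 0 * ω 1]) :
    0 < |ω₀| * Real.sqrt ((I₂ - I₁) * (I₃ - I₂) / (I₁ * I₃)) ∧
    Module.End.HasEigenvalue
      ((fderiv ℝ F ![0, ω₀, 0]).toLinearMap : Module.End ℝ (Fin 3 → ℝ))
      (|ω₀| * Real.sqrt ((I₂ - I₁) * (I₃ - I₂) / (I₁ * I₃))) := by
  obtain rfl : F = fun ω => ![((I₂ - I₃) / I₁) * ω 1 * ω 2,
    ((I₃ - I₁) / I₂) * ω 2 * ω 0, ((I₁ - I₂) / I₃) * ω 0 * ω 1] := funext hF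
  have h₃ : 0 < I₃ := by linarith
  have hrad : 0 < (I₂ - I₁) * (I₃ - I₂) / (I₁ * I₃) :=
    div_pos (mul_pos (sub_pos.2 h₁₂) (sub_pos.2 h₂₃)) (mul_pos h₀ h₃)
  have hpos := mul_pos (abs_pos.2 hω₀) (Real.sqrt_pos.2 hrad)
  have hsq : (|ω₀| * √((I₂ - I₁) * (I₃ - I₂) / (I₁ * I₃))) ^ 2 =
      (I₁ - I₂) / I₃ * ω₀ * ((I₂ - I₃) / I₁ * ω₀) := by
    rw [mul_pow, sq_abs, Real.sq_sqrt hrad.le]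
    field_simp
    ring
  refine ⟨hpos, ?_⟩
  generalize |ω₀| * √((I₂ - I₁) * (I₃ - I₂) / (I₁ * I₃)) = l at hpos hsq ⊢
  refine Module.End.hasEigenvalue_of_hasEigenvector (x := ![(I₂ - I₃) / I₁ * ω₀, 0, l])
    ⟨Module.End.mem_eigenspace_iff.2 ?_, fun h => hpos.ne' (congrFun h 2)⟩
  refine (fderiv_euler_apply _ _ _ ω₀ _).trans ?_
  ext i
  fin_cases i
  · simp [mul_comm]
  · simp
  · simpa [sq] using hsq.symm
end
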